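/- For every complex number a, the Z₁₁ singularity f = x³ y + y⁵ + a x y⁴ has Milnor number 11; that is, the quotient of the formal power series ring ℂ[[x,y]] by the ideal generated by the partial derivatives ∂f/∂x = 3x²y + a y⁴ and ∂f/∂y = x³ + 5y⁴ + 4a x y³ is an 11-dimensional vector space over ℂ. -/

import Mathlib

open MvPolynomial

namespace MvPowerSeries

variable {R : Type*} [CommRing R]

/-- The coefficient of `x ^ i * y ^ j` in a power series in two variables. -/
noncomputable def coeffXY (i j : ℕ) : MvPowerSeries (Fin 2) R →ₗ[R] R :=
  coeff (Finsupp.single 0 i + Finsupp.single 1 j)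

theorem coeffXY_mul_X_pow (i j k l : ℕ) (c : R) (F : MvPowerSeries (Fin 2) R) :
    coeffXY i j (F * (C c * X 0 ^ k * X 1 ^ l)) =
      if k ≤ i ∧ l ≤ j then coeffXY (i - k) (j - l) F * c else 0 := by
  have hmon : (C c * X 0 ^ k * X 1 ^ l : MvPowerSeries (Fin 2) R) =
      monomial (Finsupp.single 0 k + Finsupp.single 1 l) c := by
    rw [X_pow_eq, X_pow_eq, ← monomial_zero_eq_C_apply, monomial_mul_monomial,
      monomial_mul_monomial]
    simp
  have hle : (Finsupp.single (0 : Fin 2) k + Finsupp.single 1 l ≤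
      Finsupp.single 0 i + Finsupp.single 1 j) ↔ k ≤ i ∧ l ≤ j := by
    simp [Finsupp.le_def, Fin.forall_fin_two]
  have hsub : Finsupp.single (0 : Fin 2) i + Finsupp.single 1 j -
      (Finsupp.single 0 k + Finsupp.single 1 l) =
      Finsupp.single 0 (i - k) + Finsupp.single 1 (j - l) := by
    ext s
    fin_cases s <;> simp
  simp only [coeffXY, hmon, coeff_mul_monomial, hle, hsub]

theorem coeffXY_X_pow (i j k l : ℕ) (c : R) :
    coeffXY i j (C c * X 0 ^ k * X 1 ^ l : MvPowerSeries (Fin 2) R) =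
      if i = k ∧ j = l then c else 0 := by
  have h := coeffXY_mul_X_pow i j k l c 1
  rw [one_mul] at h
  have hone (p q : ℕ) : coeffXY p q (1 : MvPowerSeries (Fin 2) R) =
      if p = 0 ∧ q = 0 then 1 else 0 := by
    classical
    simp [coeffXY, coeff_one, Finsupp.ext_iff, Fin.forall_fin_two]
  rw [h, hone]
  split_ifs <;> first | omega | simp

theorem exists_eq_add_X_pow_mul (m n : ℕ) (F : MvPowerSeries (Fin 2) R) :
    ∃ A B : MvPowerSeries (Fin 2) R,
      F = ∑ i ∈ Finset.range m, ∑ j ∈ Finset.range n, C (coeffXY i j F) * X 0 ^ i * X 1 ^ j +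
        X 0 ^ m * A + X 1 ^ n * B := by
  set P := ∑ i ∈ Finset.range m, ∑ j ∈ Finset.range n,
    (C (coeffXY i j F) * X 0 ^ i * X 1 ^ j : MvPowerSeries (Fin 2) R) with hP
  let G : MvPowerSeries (Fin 2) R := fun d => if m ≤ d 0 then coeff d (F - P) else 0
  have hG (d) : coeff d G = if m ≤ d 0 then coeff d (F - P) else 0 := rfl
  obtain ⟨A, hA⟩ : (X 0 ^ m : MvPowerSeries (Fin 2) R) ∣ G := by
    rw [X_pow_dvd_iff]
    intro d hd
    rw [hG, if_neg (by omega)]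
  obtain ⟨B, hB⟩ : (X 1 ^ n : MvPowerSeries (Fin 2) R) ∣ F - P - G := by
    rw [X_pow_dvd_iff]
    intro d hd
    rw [map_sub, hG]
    split_ifs with h
    · simp
    · have hd' : d = Finsupp.single 0 (d 0) + Finsupp.single 1 (d 1) := by
        ext s
        fin_cases s <;> simp
      have hc : coeff d P = coeffXY (d 0) (d 1) P := by rw [coeffXY, ← hd']
      have hcF : coeff d F = coeffXY (d 0) (d 1) F := by rw [coeffXY, ← hd']
      rw [sub_zero, map_sub, hc, hcF, hP]
      simp only [map_sum, coeffXY_X_pow]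
      rw [Finset.sum_eq_single (d 0), Finset.sum_eq_single (d 1)]
      · simp
      · intro j _ hj
        simp [hj.symm]
      · simp [hd]
      · intro i _ hi
        simp [hi.symm]
      · simp [not_le.mp h]
  exact ⟨A, B, by linear_combination hA + hB⟩

end MvPowerSeries

namespace SingularityZ11

open MvPowerSeries (coeffXY)

/-- The coordinates of a power series modulo the Jacobian ideal of `x³y + y⁵ + axy⁴`, up to
nonzero scalars, in the basis `1, y, y², y³, y⁴, x, xy, xy², xy³, xy⁴, x²`. -/
noncomputable def normalForm (a : ℂ) : MvPowerSeries (Fin 2) ℂ →ₗ[ℂ] (Fin 11 → ℂ) :=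
  LinearMap.pi ![coeffXY 0 0, coeffXY 0 1, coeffXY 0 2, coeffXY 0 3,
    (3 : ℂ) • coeffXY 0 4 - a • coeffXY 2 1 - (15 : ℂ) • coeffXY 3 0,
    coeffXY 1 0, coeffXY 1 1, coeffXY 1 2,
    coeffXY 1 3 - (4 * a) • coeffXY 3 0,
    (45 : ℂ) • coeffXY 1 4 - (33 * a) • coeffXY 0 5 + (11 * a ^ 2) • coeffXY 2 2
      - (15 * a) • coeffXY 3 1 - (225 : ℂ) • coeffXY 4 0,
    coeffXY 2 0]

theorem normalForm_eq_zero_iff (a : ℂ) (F : MvPowerSeries (Fin 2) ℂ) :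
    normalForm a F = 0 ↔
      coeffXY 0 0 F = 0 ∧ coeffXY 0 1 F = 0 ∧ coeffXY 0 2 F = 0 ∧ coeffXY 0 3 F = 0 ∧
      3 * coeffXY 0 4 F - a * coeffXY 2 1 F - 15 * coeffXY 3 0 F = 0 ∧
      coeffXY 1 0 F = 0 ∧ coeffXY 1 1 F = 0 ∧ coeffXY 1 2 F = 0 ∧
      coeffXY 1 3 F - 4 * a * coeffXY 3 0 F = 0 ∧
      45 * coeffXY 1 4 F - 33 * a * coeffXY 0 5 F + 11 * a ^ 2 * coeffXY 2 2 F
        - 15 * a * coeffXY 3 1 F - 225 * coeffXY 4 0 F = 0 ∧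
      coeffXY 2 0 F = 0 := by
  simp [funext_iff, Fin.forall_fin_succ, normalForm]

theorem normalForm_surjective (a : ℂ) : Function.Surjective (normalForm a) := by
  intro v
  let t (c : ℂ) (i j : ℕ) : MvPowerSeries (Fin 2) ℂ :=
    MvPowerSeries.C c * MvPowerSeries.X 0 ^ i * MvPowerSeries.X 1 ^ j
  refine ⟨t (v 0) 0 0 + t (v 1) 0 1 + t (v 2) 0 2 + t (v 3) 0 3 + t (v 4 / 3) 0 4 +
    t (v 5) 1 0 + t (v 6) 1 1 + t (v 7) 1 2 + t (v 8) 1 3 + t (v 9 / 45) 1 4 + t (v 10) 2 0, ?_⟩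
  have ht (i j k l : ℕ) (c : ℂ) : coeffXY i j (t c k l) = if i = k ∧ j = l then c else 0 :=
    MvPowerSeries.coeffXY_X_pow i j k l c
  clear_value t
  ext s
  fin_cases s <;> simp [normalForm, ht] <;> ring

/-- The partial derivative of `x³y + y⁵ + axy⁴` with respect to `x`. -/
noncomputable def derivX (a : ℂ) : MvPowerSeries (Fin 2) ℂ :=
  3 * MvPowerSeries.X 0 ^ 2 * MvPowerSeries.X 1 + MvPowerSeries.C a * MvPowerSeries.X 1 ^ 4

/-- The partial derivative of `x³y + y⁵ + axy⁴` with respect to `y`. -/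
noncomputable def derivY (a : ℂ) : MvPowerSeries (Fin 2) ℂ :=
  MvPowerSeries.X 0 ^ 3 + 5 * MvPowerSeries.X 1 ^ 4 +
    4 * MvPowerSeries.C a * MvPowerSeries.X 0 * MvPowerSeries.X 1 ^ 3

theorem normalForm_mul_derivX (a : ℂ) (F : MvPowerSeries (Fin 2) ℂ) :
    normalForm a (F * derivX a) = 0 := by
  have h (i j : ℕ) : coeffXY i j (F * derivX a) =
      (if 2 ≤ i ∧ 1 ≤ j then coeffXY (i - 2) (j - 1) F * 3 else 0) +
      (if 0 ≤ i ∧ 4 ≤ j then coeffXY (i - 0) (j - 4) F * a else 0) := by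
    rw [← MvPowerSeries.coeffXY_mul_X_pow, ← MvPowerSeries.coeffXY_mul_X_pow, ← map_add, derivX]
    congr 1
    simp only [map_ofNat]
    ring
  rw [normalForm_eq_zero_iff]
  simp [h]
  ring_nf
  simp

theorem normalForm_mul_derivY (a : ℂ) (F : MvPowerSeries (Fin 2) ℂ) :
    normalForm a (F * derivY a) = 0 := by
  have h (i j : ℕ) : coeffXY i j (F * derivY a) =
      (if 3 ≤ i ∧ 0 ≤ j then coeffXY (i - 3) (j - 0) F * 1 else 0) +
      (if 0 ≤ i ∧ 4 ≤ j then coeffXY (i - 0) (j - 4) F * 5 else 0) +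
      (if 1 ≤ i ∧ 3 ≤ j then coeffXY (i - 1) (j - 3) F * (4 * a) else 0) := by
    rw [← MvPowerSeries.coeffXY_mul_X_pow, ← MvPowerSeries.coeffXY_mul_X_pow,
      ← MvPowerSeries.coeffXY_mul_X_pow, ← map_add, ← map_add, derivY]
    congr 1
    simp only [map_ofNat, map_mul, map_one]
    ring
  rw [normalForm_eq_zero_iff]
  simp [h]
  ring_nf
  simp

theorem mem_of_normalForm_eq_zero {a : ℂ} {F : MvPowerSeries (Fin 2) ℂ}
    (hF : normalForm a F = 0) : F ∈ Ideal.span {derivX a, derivY a} := by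
  set I := Ideal.span {derivX a, derivY a}
  let π := Ideal.Quotient.mk I
  let κ : ℂ →+* MvPowerSeries (Fin 2) ℂ ⧸ I := π.comp MvPowerSeries.C
  set x := π (MvPowerSeries.X 0) with hx
  set y := π (MvPowerSeries.X 1) with hy
  have hX : 3 * x ^ 2 * y + κ a * y ^ 4 = 0 := by
    have : π (derivX a) = 0 := Ideal.Quotient.eq_zero_iff_mem.2 (Ideal.subset_span (by simp))
    simpa only [derivX, hx, hy, κ, RingHom.comp_apply, map_add, map_mul, map_pow, map_ofNat]
      using this
  have hY : x ^ 3 + 5 * y ^ 4 + 4 * κ a * x * y ^ 3 = 0 := by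
    have : π (derivY a) = 0 := Ideal.Quotient.eq_zero_iff_mem.2 (Ideal.subset_span (by simp))
    simpa only [derivY, hx, hy, κ, RingHom.comp_apply, map_add, map_mul, map_pow, map_ofNat]
      using this
  have cancel {n : ℂ} (hn : n ≠ 0) {z : MvPowerSeries (Fin 2) ℂ ⧸ I} (h : κ n * z = 0) : z = 0 :=
    ((IsUnit.mk0 n hn).map κ).mul_right_eq_zero.1 h
  have y5 : 15 * y ^ 5 = -11 * κ a * x * y ^ 4 := by
    linear_combination 3 * y * hY - x * hX
  have xy5 : x * y ^ 5 = 0 := by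
    have hu : IsUnit (675 + 121 * κ a ^ 3 * y) := by
      have : IsUnit (MvPowerSeries.C 675 + MvPowerSeries.C (121 * a ^ 3) * MvPowerSeries.X 1 :
          MvPowerSeries (Fin 2) ℂ) := by
        rw [MvPowerSeries.isUnit_iff_constantCoeff]
        simp
      simpa only [κ, hy, RingHom.comp_apply, map_add, map_mul, map_pow, map_ofNat]
        using this.map π
    refine hu.mul_right_eq_zero.1 ?_
    linear_combination 45 * x * y5 - 165 * κ a * y ^ 3 * hX + 11 * κ a ^ 2 * y ^ 2 * y5
  have y6 : y ^ 6 = 0 := by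
    refine cancel (n := 15) (by norm_num) ?_
    rw [map_ofNat]
    linear_combination y * y5 - 11 * κ a * xy5
  have x2y3 : x ^ 2 * y ^ 3 = 0 := by
    refine cancel (n := 3) (by norm_num) ?_
    rw [map_ofNat]
    linear_combination y ^ 2 * hX - κ a * y6
  have x3y2 : x ^ 3 * y ^ 2 = 0 := by
    linear_combination y ^ 2 * hY - 5 * y6 - 4 * κ a * xy5
  have x4 : x ^ 4 = -5 * x * y ^ 4 := by
    linear_combination x * hY - 4 * κ a * x2y3
  have x4y : x ^ 4 * y = 0 := by linear_combination y * x4 - 5 * xy5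
  have x5 : x ^ 5 = 0 := by linear_combination x * x4 - 5 * y * x2y3
  obtain ⟨A, B, hAB⟩ := MvPowerSeries.exists_eq_add_X_pow_mul 5 6 F
  have hπ := congrArg π hAB
  obtain ⟨h00, h01, h02, h03, h04, h10, h11, h12, h13, h14, h20⟩ :=
    (normalForm_eq_zero_iff a F).1 hF
  have k04 := congrArg κ h04
  have k13 := congrArg κ h13
  have k14 := congrArg κ h14
  have hC (c : ℂ) : π (MvPowerSeries.C c) = κ c := rfl
  simp only [Finset.sum_range_succ, Finset.sum_range_zero, map_add, map_mul, map_pow, hC,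
    ← hx, ← hy, h00, h01, h02, h03, h10, h11, h12, h20, map_zero] at hπ
  simp only [map_add, map_sub, map_mul, map_pow, map_ofNat, map_zero] at k04 k13 k14
  rw [← Ideal.Quotient.eq_zero_iff_mem]
  refine cancel (n := 45) (by norm_num) ?_
  rw [map_ofNat]
  change 45 * π F = 0
  generalize π F = p at hπ ⊢
  generalize κ a = α at *
  have x2y2 : 45 * (x ^ 2 * y ^ 2) = 11 * α ^ 2 * x * y ^ 4 := by
    linear_combination 15 * y * hX - α * y5
  have x3y : 3 * (x ^ 3 * y) = - α * x * y ^ 4 := by linear_combination x * hX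
  linear_combination 45 * hπ + 15 * y ^ 4 * k04 + 45 * x * y ^ 3 * k13 + x * y ^ 4 * k14
    + 3 * κ (coeffXY 0 5 F) * y5 + 15 * κ (coeffXY 2 1 F) * hX + κ (coeffXY 2 2 F) * x2y2
    + 45 * κ (coeffXY 3 0 F) * hY + 15 * κ (coeffXY 3 1 F) * x3y
    + 45 * κ (coeffXY 4 0 F) * x4
    + 45 * (κ (coeffXY 1 5 F) * xy5
      + (κ (coeffXY 2 3 F) + κ (coeffXY 2 4 F) * y + κ (coeffXY 2 5 F) * y ^ 2) * x2y3
      + (κ (coeffXY 3 2 F) + κ (coeffXY 3 3 F) * y + κ (coeffXY 3 4 F) * y ^ 2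
        + κ (coeffXY 3 5 F) * y ^ 3) * x3y2
      + (κ (coeffXY 4 1 F) + κ (coeffXY 4 2 F) * y + κ (coeffXY 4 3 F) * y ^ 2
        + κ (coeffXY 4 4 F) * y ^ 3 + κ (coeffXY 4 5 F) * y ^ 4) * x4y
      + π A * x5 + π B * y6)

theorem mem_span_deriv_iff (a : ℂ) (F : MvPowerSeries (Fin 2) ℂ) :
    F ∈ Ideal.span {derivX a, derivY a} ↔ normalForm a F = 0 := by
  refine ⟨fun h => ?_, mem_of_normalForm_eq_zero⟩
  obtain ⟨p, q, rfl⟩ := Ideal.mem_span_pair.1 h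
  rw [map_add, normalForm_mul_derivX, normalForm_mul_derivY, add_zero]

end SingularityZ11

open SingularityZ11 in
theorem milnor_number_Z11 (a : ℂ)
    (f : MvPolynomial (Fin 2) ℂ)
    (hf : f = X 0 ^ 3 * X 1 + X 1 ^ 5 + C a * X 0 * X 1 ^ 4) :
    Module.finrank ℂ
      (MvPowerSeries (Fin 2) ℂ ⧸
        Ideal.span {(↑(pderiv 0 f) : MvPowerSeries (Fin 2) ℂ), ↑(pderiv 1 f)}) = 11 := by
  have hX : ((pderiv 0 f : MvPolynomial (Fin 2) ℂ) : MvPowerSeries (Fin 2) ℂ) = derivX a := by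
    have : pderiv 0 f = C 3 * X 0 ^ 2 * X 1 + C a * X 1 ^ 4 := by
      simp [hf, pderiv_X, Derivation.leibniz_pow]
      simp only [map_ofNat]
      ring
    rw [this]
    simp only [derivX, coe_add, coe_mul, coe_pow, coe_C, coe_X]
    simp only [map_ofNat]
  have hY : ((pderiv 1 f : MvPolynomial (Fin 2) ℂ) : MvPowerSeries (Fin 2) ℂ) = derivY a := by
    have : pderiv 1 f = X 0 ^ 3 + C 5 * X 1 ^ 4 + C 4 * C a * X 0 * X 1 ^ 3 := by
      simp [hf, pderiv_X, Derivation.leibniz_pow]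
      simp only [map_ofNat]
      ring
    rw [this]
    simp only [derivY, coe_add, coe_mul, coe_pow, coe_C, coe_X]
    simp only [map_ofNat]
  rw [hX, hY]
  set I := Ideal.span {derivX a, derivY a}
  let π := (Ideal.Quotient.mkₐ ℂ I).toLinearMap
  have hker : LinearMap.ker π = LinearMap.ker (normalForm a) := by
    ext F
    rw [LinearMap.mem_ker, LinearMap.mem_ker, ← mem_span_deriv_iff]
    exact Ideal.Quotient.eq_zero_iff_mem
  have e := (π.quotKerEquivOfSurjective (Ideal.Quotient.mkₐ_surjective ℂ I)).symm ≪≫ₗ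
    Submodule.quotEquivOfEq _ _ hker ≪≫ₗ
    (normalForm a).quotKerEquivOfSurjective (normalForm_surjective a)
  rw [e.finrank_eq, Module.finrank_fin_fun]
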